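/- Let k ≥ 1, let p_1, …, p_k ∈ ℝ², and let L = {a + t • v : t ∈ ℝ} and L' = {a' + t • v' : t ∈ ℝ} be two parallel lines in ℝ² (i.e., v' is a nonzero scalar multiple of v). If L' = {2 Σ_{m=1}^{k} (−1)^{k−m} p_m + (−1)^k • x : x ∈ L}, then for every point q* ∈ L there exists exactly one polygonal curve q_0, q_1, …, q_k in ℝ² with q_0 = q*, q_k ∈ L', and p_j = (q_{j−1} + q_j)/2 for j = 1, …, k. -/

import Mathlib

noncomputable section

/-- The plane. -/
abbrev E2 := EuclideanSpace ℝ (Fin 2)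

/-- The line through `a` with direction vector `v`. -/
def LineThrough (a v : E2) : Set E2 := {x : E2 | ∃ t : ℝ, x = a + t • v}

/-- The `n`-th vertex of the polygonal curve starting at `x` with midpoints `p 1, p 2, …`. -/
def midpointCurve {V : Type*} [AddCommGroup V] [Module ℝ V] (p : ℕ → V) (x : V) (n : ℕ) : V :=
  (2 : ℝ) • (∑ m ∈ Finset.Icc 1 n, (-1 : ℝ) ^ (n - m) • p m) + (-1 : ℝ) ^ n • x

theorem midpointCurve_zero {V : Type*} [AddCommGroup V] [Module ℝ V] (p : ℕ → V) (x : V) :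
    midpointCurve p x 0 = x := by
  simp [midpointCurve]

theorem midpointCurve_succ {V : Type*} [AddCommGroup V] [Module ℝ V] (p : ℕ → V) (x : V)
    (n : ℕ) : midpointCurve p x (n + 1) = (2 : ℝ) • p (n + 1) - midpointCurve p x n := by
  have h : ∑ m ∈ Finset.Icc 1 n, (-1 : ℝ) ^ (n + 1 - m) • p m =
      -∑ m ∈ Finset.Icc 1 n, (-1 : ℝ) ^ (n - m) • p m := by
    rw [← Finset.sum_neg_distrib]
    refine Finset.sum_congr rfl fun m hm => ?_
    rw [Nat.succ_sub (Finset.mem_Icc.mp hm).2, pow_succ]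
    module
  unfold midpointCurve
  rw [Finset.sum_Icc_succ_top (Nat.le_add_left 1 n), h, Nat.sub_self, pow_succ]
  module

theorem eq_midpoint_iff_eq_two_smul_sub {V : Type*} [AddCommGroup V] [Module ℝ V] (m x y : V) :
    m = midpoint ℝ x y ↔ y = (2 : ℝ) • m - x := by
  rw [midpoint_eq_smul_add, invOf_eq_inv]
  constructor
  · rintro rfl
    module
  · rintro rfl
    module

theorem stmt7 (k : ℕ) (hk : 1 ≤ k) (p : ℕ → E2) (a v a' v' : E2)
    (hv : v ≠ 0) (c : ℝ) (hc : c ≠ 0) (hpar : v' = c • v)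
    (hL : LineThrough a' v' =
      (fun x : E2 => (2 : ℝ) • (∑ m ∈ Finset.Icc 1 k, ((-1 : ℝ)) ^ (k - m) • p m) +
        ((-1 : ℝ)) ^ k • x) '' LineThrough a v) :
    ∀ qstar ∈ LineThrough a v,
      ∃! q : Fin (k + 1) → E2,
        q 0 = qstar ∧ q (Fin.last k) ∈ LineThrough a' v' ∧
        ∀ j : Fin k, p (j.val + 1) = midpoint ℝ (q j.castSucc) (q j.succ) := by
  intro x hx
  refine ⟨fun j => midpointCurve p x j, ⟨midpointCurve_zero p x, ?_, fun j => ?_⟩, ?_⟩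
  · rw [hL]
    exact ⟨x, hx, rfl⟩
  · rw [eq_midpoint_iff_eq_two_smul_sub]
    exact midpointCurve_succ p x j
  · rintro q ⟨h0, -, hq⟩
    funext j
    induction j using Fin.induction with
    | zero => exact h0.trans (midpointCurve_zero p x).symm
    | succ j ih =>
      rw [(eq_midpoint_iff_eq_two_smul_sub _ _ _).mp (hq j), ih]
      exact (midpointCurve_succ p x j).symm
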